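/- For every integer n ≥ 1, the derivative of the n-th Fibonacci polynomial satisfies F_n'(x) = Σ_{i=1}^{n-1} i · sin((n-i)π/2) · F_i(x) for all real x. -/

import Mathlib

open Polynomial Real

/-- The Fibonacci polynomials: `F 1 = 1`, `F 2 = X`, and
`F (r+1) = X * F r + F (r-1)` (with the convention `F 0 = 0`). -/
noncomputable def fibPoly : ℕ → Polynomial ℝ
  | 0 => 0
  | 1 => 1
  | (n + 2) => Polynomial.X * fibPoly (n + 1) + fibPoly n

theorem fibPoly_add_two (n : ℕ) :
    fibPoly (n + 2) = Polynomial.X * fibPoly (n + 1) + fibPoly n := by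
  rw [fibPoly]

theorem derivative_fibPoly_add_two (n : ℕ) :
    derivative (fibPoly (n + 2)) =
      fibPoly (n + 1) + Polynomial.X * derivative (fibPoly (n + 1)) + derivative (fibPoly n) := by
  simp [fibPoly_add_two]

theorem derivative_fibPoly_add_two_add_derivative (n : ℕ) :
    derivative (fibPoly (n + 2)) + derivative (fibPoly n) =
      ((n : Polynomial ℝ) + 1) * fibPoly (n + 1) := by
  induction n using Nat.twoStepInduction with
  | zero => simp [fibPoly]
  | one => simp [fibPoly]; ring
  | more n ih₀ ih₁ =>
    rw [derivative_fibPoly_add_two (n + 2)]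
    have h := derivative_fibPoly_add_two n
    have hF := fibPoly_add_two (n + 1)
    simp only [add_assoc, Nat.reduceAdd] at *
    push_cast at *
    linear_combination Polynomial.X * ih₁ + ih₀ + h - ((n : Polynomial ℝ) + 2) * hF

theorem eval_derivative_fibPoly (n : ℕ) (x : ℝ) :
    (derivative (fibPoly n)).eval x =
      ∑ i ∈ Finset.range n,
        (i : ℝ) * Real.sin (((n : ℝ) - (i : ℝ)) * Real.pi / 2) * (fibPoly i).eval x := by
  induction n using Nat.twoStepInduction with
  | zero => simp [fibPoly]
  | one => simp [fibPoly]
  | more n ih _ =>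
    have h := congrArg (Polynomial.eval x) (derivative_fibPoly_add_two_add_derivative n)
    simp only [eval_add, eval_mul, eval_natCast, eval_one] at h
    have hsin (i : ℕ) : Real.sin ((((n + 2 : ℕ) : ℝ) - i) * Real.pi / 2) =
        -Real.sin (((n : ℝ) - i) * Real.pi / 2) := by
      rw [← Real.sin_add_pi]
      congr 1
      push_cast
      ring
    have hlast : Real.sin (((n : ℝ) - (n + 1 : ℕ)) * Real.pi / 2) = -1 := by
      rw [← Real.sin_pi_div_two, ← Real.sin_neg]
      congr 1
      push_cast
      ring
    simp only [hsin, Finset.sum_range_succ, hlast, mul_neg, neg_mul, Finset.sum_neg_distrib, ← ih,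
      sub_self, zero_mul, zero_div, Real.sin_zero, mul_zero]
    push_cast
    linear_combination h

/-- For every `n ≥ 1`, the derivative of the `n`-th Fibonacci polynomial satisfies
`Fₙ'(x) = ∑_{i=1}^{n-1} i · sin((n-i)π/2) · Fᵢ(x)` for all real `x`. -/
theorem fibPoly_deriv (n : ℕ) (hn : 1 ≤ n) (x : ℝ) :
    deriv (fun t : ℝ => (fibPoly n).eval t) x =
      ∑ i ∈ Finset.Icc 1 (n - 1),
        (i : ℝ) * Real.sin (((n : ℝ) - (i : ℝ)) * Real.pi / 2) * (fibPoly i).eval x := by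
  rw [Polynomial.deriv, eval_derivative_fibPoly]
  refine (Finset.sum_subset (fun i hi => ?_) fun i hi hi' => ?_).symm
  · simp only [Finset.mem_Icc, Finset.mem_range] at *
    omega
  · simp only [Finset.mem_Icc, Finset.mem_range] at *
    obtain rfl : i = 0 := by omega
    simp
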